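/- arXiv:0904.2257 — 2 statements merged into one kernel-verified Lean document; each statement's English description precedes it below -/
import Mathlib

section
/- Let X₁ be a finite alphabet and let g₁, g₂: X₁* → X₁* be primitive morphisms. Let x ∈ X₁ be a letter such that g₁^ω(x) and g₂^ω(x) exist and are equal. If g₁g₂ and g₂g₁ are primitive, then there exists a positive integer K such that ||g₁g₂(w)| − |g₂g₁(w)|| ≤ K whenever w is a factor of g₁^ω(x). -/
open Filter Set

variable {X : Type*}

/-- Apply the morphism with letter images `g` to a word. -/
def applyM (g : X → List X) (w : List X) : List X := w.flatMap g

/-- `iterM g k w` is `g^k(w)`. -/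
def iterM (g : X → List X) (k : ℕ) (w : List X) : List X := (applyM g)^[k] w

/-- The letter map of the composition `g ∘ h` (first `h`, then `g`). -/
def compM (g h : X → List X) : X → List X := fun a => applyM g (h a)

/-- The letter map of the power `g^k`. -/
def powM (g : X → List X) (k : ℕ) : X → List X := fun a => iterM g k [a]

/-- A morphism is primitive if some power maps every letter to a word containing every letter. -/
def Primitive (g : X → List X) : Prop := ∃ k : ℕ, 0 < k ∧ ∀ a b : X, a ∈ iterM g k [b]

/-- `Mg g` is the maximal length of the image of a letter. -/
def Mg [Fintype X] (g : X → List X) : ℕ := Finset.univ.sup fun x => (g x).length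

/-- A morphism is growing if the lengths of iterated images of every letter tend to infinity. -/
def Growing (g : X → List X) : Prop :=
  ∀ x : X, Tendsto (fun i => (iterM g i [x]).length) atTop atTop

/-- `w` is a (finite) prefix of the infinite word `s`. -/
def IsPrefI (w : List X) (s : ℕ → X) : Prop := ∀ i (h : i < w.length), w[i]'h = s i

/-- `v` is a factor of the infinite word `s`. -/
def IsFactorI (v : List X) (s : ℕ → X) : Prop :=
  ∃ j : ℕ, ∀ i (h : i < v.length), v[i]'h = s (j + i)

/-- `g^ω(x)` exists. -/
def OmegaExists (g : X → List X) (x : X) : Prop :=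
  [x] <+: g x ∧ Tendsto (fun i => (iterM g i [x]).length) atTop atTop

/-- `s = g^ω(x)`. -/
def IsOmega (g : X → List X) (x : X) (s : ℕ → X) : Prop :=
  OmegaExists g x ∧ ∀ i : ℕ, IsPrefI (iterM g i [x]) s

/-- `s = u^ω` for the nonempty word `u`. -/
def IsPeriodicWord (s : ℕ → X) (u : List X) : Prop :=
  u ≠ [] ∧ ∀ (i : ℕ) (h : i % u.length < u.length), s i = u[i % u.length]'h

/-- A morphism is looping. -/
def Looping (g : X → List X) : Prop :=
  ∃ k : ℕ, 0 < k ∧ ∃ x : X, ∃ u : List X, ∃ s : ℕ → X,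
    IsOmega (powM g k) x s ∧ IsPeriodicWord s u

/-- A morphism is loop-free if it is not looping. -/
def LoopFree (g : X → List X) : Prop := ¬ Looping g

/-- `p` is a period of `u`. -/
def HasPeriod (u : List X) (p : ℕ) : Prop :=
  0 < p ∧ ∀ i : ℕ, i + p < u.length → u[i + p]? = u[i]?

/-- The smallest period of `u`. -/
noncomputable def PER (u : List X) : ℕ := sInf {p | HasPeriod u p}

/-- A primitive word: nonempty and not a proper power of a shorter word. -/
def PrimitiveWord (u : List X) : Prop :=
  u ≠ [] ∧ ¬∃ (v : List X) (j : ℕ), 2 ≤ j ∧ v.length < u.length ∧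
    u = (List.replicate j v).flatten

/-- `COMP g h` : the set of words whose images under `g` and `h` are prefix-comparable. -/
def COMP (g h : X → List X) : Set (List X) :=
  {w | ∃ u₁ u₂ : List X, applyM g w ++ u₁ = applyM h w ++ u₂}

/-- `BAL g h`. -/
noncomputable def BAL (g h : X → List X) : ℕ∞ :=
  ⨆ (x : X) (k : ℕ),
    ((((applyM g (iterM g k [x])).length : ℤ) -
      ((applyM h (iterM g k [x])).length : ℤ)).natAbs : ℕ∞)

/-- The set of factors of length `q` of the word `w`. -/
def Fq (q : ℕ) (w : List X) : Set (List X) := {v | v.length = q ∧ v <:+: w}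

/-- The set of factors of length `q` of words of `L`. -/
def FqL (q : ℕ) (L : Set (List X)) : Set (List X) := ⋃ w ∈ L, Fq q w

/-- `A n = ⌊9 n³ √(n log n)⌋`. -/
noncomputable def Abound (n : ℕ) : ℕ := ⌊9 * (n : ℝ)^3 * Real.sqrt (n * Real.log n)⌋₊

/-- Prefix sums of a weight along `s`. -/
def SmW (φ : X → ℝ) (s : ℕ → X) (n : ℕ) : ℝ := ∑ i ∈ Finset.range n, φ (s i)

/-- The factor of `s` at position `i` of length `l`. -/
def FacW (s : ℕ → X) (i l : ℕ) : List X := (List.range l).map (fun t => s (i + t))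

/-- Weight of a word. -/
def wtW (φ : X → ℝ) (w : List X) : ℝ := (w.map φ).sum

/-- The morphism fixes `s`. -/
def FixW (g : X → List X) (s : ℕ → X) : Prop := ∀ n, IsPrefI (applyM g (FacW s 0 n)) s

/-- Length of the image of the prefix of length `n`. -/
def posW (g : X → List X) (s : ℕ → X) (n : ℕ) : ℕ := (applyM g (FacW s 0 n)).length

lemma facW_length (s : ℕ → X) (i l : ℕ) : (FacW s i l).length = l := by simp [FacW]

lemma facW_add (s : ℕ → X) (i l m : ℕ) : FacW s i (l + m) = FacW s i l ++ FacW s (i + l) m := by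
  simp [FacW, List.range_add, List.map_append, Function.comp_def, add_assoc]

lemma facW_one (s : ℕ → X) (i : ℕ) : FacW s i 1 = [s i] := by simp [FacW]

lemma prefI_eq {w : List X} {s : ℕ → X} (h : IsPrefI w s) : w = FacW s 0 w.length := by
  apply List.ext_getElem
  · simp [FacW]
  · intro i h1 h2
    simp [FacW, h i h1]

lemma applyM_append (g : X → List X) (u v : List X) :
    applyM g (u ++ v) = applyM g u ++ applyM g v := by simp [applyM]

lemma applyM_single (g : X → List X) (a : X) : applyM g [a] = g a := by simp [applyM]

lemma applyM_comp (g f : X → List X) (w : List X) :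
    applyM g (applyM f w) = applyM (compM g f) w := by
  have : compM g f = fun x => List.flatMap g (f x) := rfl
  simp only [applyM, this, List.flatMap_assoc]

lemma applyM_powM (g : X → List X) (k : ℕ) (w : List X) : applyM (powM g k) w = iterM g k w := by
  induction k with
  | zero =>
    have : powM g 0 = fun a => [a] := rfl
    simp [applyM, this, iterM]
  | succ k ih =>
    have : powM g (k+1) = compM g (powM g k) := by
      funext a
      simp [powM, compM, iterM, Function.iterate_succ_apply']
    rw [this, ← applyM_comp, ih]
    simp [iterM, Function.iterate_succ_apply']

lemma powM_add (g : X → List X) (k m : ℕ) (b : X) :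
    powM g (k + m) b = applyM (powM g k) (powM g m b) := by
  rw [applyM_powM]
  simp [powM, iterM, Function.iterate_add_apply]

lemma iterM_append (g : X → List X) (k : ℕ) (u v : List X) :
    iterM g k (u ++ v) = iterM g k u ++ iterM g k v := by
  simp only [← applyM_powM, applyM_append]

lemma fix_of_omega {g : X → List X} {x : X} {s : ℕ → X} (h : IsOmega g x s) : FixW g s := by
  intro n
  obtain ⟨i, hi⟩ := (h.1.2.eventually_ge_atTop n).exists
  have e := prefI_eq (h.2 i)
  obtain ⟨m, hm⟩ := Nat.exists_eq_add_of_le hi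
  rw [hm, facW_add] at e
  have e2 := h.2 (i+1)
  have : iterM g (i+1) [x] = applyM g (iterM g i [x]) := by
    simp [iterM, Function.iterate_succ_apply']
  rw [this, e, applyM_append] at e2
  intro t ht
  have := e2 t (by simp; omega)
  rw [← this, List.getElem_append_left ht]

lemma fix_apply {g : X → List X} {s : ℕ → X} (h : FixW g s) (n : ℕ) :
    applyM g (FacW s 0 n) = FacW s 0 (posW g s n) := prefI_eq (h n)

lemma fix_comp {g f : X → List X} {s : ℕ → X} (hg : FixW g s) (hf : FixW f s) :
    FixW (compM g f) s := by
  intro n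
  rw [← applyM_comp, fix_apply hf]
  exact hg _

lemma fix_pow {g : X → List X} {s : ℕ → X} (hg : FixW g s) (k : ℕ) : FixW (powM g k) s := by
  induction k with
  | zero =>
    intro n t ht
    simp [applyM_powM, iterM, FacW] 
  | succ k ih =>
    have : powM g (k+1) = compM g (powM g k) := by
      funext a
      simp [powM, compM, iterM, Function.iterate_succ_apply']
    rw [this]
    exact fix_comp hg ih

lemma posW_zero (g : X → List X) (s : ℕ → X) : posW g s 0 = 0 := by simp [posW, FacW, applyM]

lemma posW_add (g : X → List X) (s : ℕ → X) (n l : ℕ) :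
    posW g s (n + l) = posW g s n + (applyM g (FacW s n l)).length := by
  simp [posW, facW_add, applyM_append]

lemma posW_succ (g : X → List X) (s : ℕ → X) (n : ℕ) :
    posW g s (n + 1) = posW g s n + (g (s n)).length := by
  rw [posW_add, facW_one, applyM_single]

lemma fix_facW {g : X → List X} {s : ℕ → X} (h : FixW g s) (n l : ℕ) :
    applyM g (FacW s n l) = FacW s (posW g s n) (applyM g (FacW s n l)).length := by
  have := fix_apply h (n + l)
  rw [posW_add, facW_add, facW_add, applyM_append, fix_apply h n] at this
  have := List.append_cancel_left this
  simpa using this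

lemma facW_get {s : ℕ → X} {i j l : ℕ} (h : FacW s i l = FacW s j l) (t : ℕ) (ht : t < l) :
    s (i + t) = s (j + t) := by
  have : (FacW s i l)[t]? = (FacW s j l)[t]? := by rw [h]
  simpa [FacW, ht] using this

lemma facW_congr {s : ℕ → X} {i j l : ℕ} (h : ∀ t, t < l → s (i + t) = s (j + t)) :
    FacW s i l = FacW s j l := by
  unfold FacW
  apply List.map_congr_left
  intro t ht
  exact h t (by simpa using ht)

/-- Equal factors have equal images, at the image positions. -/
lemma fix_agree {g : X → List X} {s : ℕ → X} (h : FixW g s) {i j l : ℕ}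
    (e : ∀ t, t < l → s (i + t) = s (j + t)) (t : ℕ)
    (ht : t < (applyM g (FacW s i l)).length) :
    s (posW g s i + t) = s (posW g s j + t) := by
  have e1 := fix_facW h i l
  have e2 := fix_facW h j l
  rw [← facW_congr e, e1] at e2
  rw [facW_length] at e2
  exact facW_get e2 t ht

lemma posW_strictMono {g : X → List X} (hne : ∀ a, g a ≠ []) (s : ℕ → X) :
    StrictMono (posW g s) := by
  apply strictMono_nat_of_lt_succ
  intro n
  rw [posW_succ]
  have := List.length_pos_iff.2 (hne (s n))
  omega

lemma posW_locate {g : X → List X} (hne : ∀ a, g a ≠ []) (s : ℕ → X) (N : ℕ) :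
    ∃ n, posW g s n ≤ N ∧ N < posW g s (n + 1) := by
  have hm := posW_strictMono hne s
  refine ⟨Nat.findGreatest (fun n => posW g s n ≤ N) N, ?_, ?_⟩
  · exact Nat.findGreatest_spec (P := fun n => posW g s n ≤ N) (Nat.zero_le N)
      (by rw [posW_zero]; omega)
  · by_contra hc
    push Not at hc
    have h1 : (Nat.findGreatest (fun n => posW g s n ≤ N) N + 1) ≤ _ := hm.id_le _
    have := Nat.le_findGreatest (P := fun n => posW g s n ≤ N) (le_trans h1 hc) hc
    omega

lemma wtW_apply (φ : X → ℝ) (f : X → List X) (w : List X) :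
    wtW φ (applyM f w) = wtW (fun b => wtW φ (f b)) w := by
  induction w with
  | nil => simp [wtW, applyM]
  | cons a w ih =>
    simp only [wtW, applyM, List.flatMap_cons, List.map_append, List.sum_append, List.map_cons,
      List.sum_cons] at ih ⊢
    rw [ih]

lemma smW_eq (φ : X → ℝ) (s : ℕ → X) (n : ℕ) : SmW φ s n = wtW φ (FacW s 0 n) := by
  induction n with
  | zero => simp [SmW, wtW, FacW]
  | succ n ih =>
    rw [facW_add, facW_one]
    simp only [SmW, Finset.sum_range_succ] at ih ⊢
    rw [ih]; simp [wtW]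

lemma smW_pos {f : X → List X} {s : ℕ → X} (h : FixW f s) (φ : X → ℝ) (n : ℕ) :
    SmW φ s (posW f s n) = SmW (fun b => wtW φ (f b)) s n := by
  rw [smW_eq, smW_eq, ← fix_apply h, wtW_apply]

lemma wtW_one (w : List X) : wtW (fun _ => 1) w = w.length := by simp [wtW]

lemma posW_eq_smW (f : X → List X) (s : ℕ → X) (n : ℕ) :
    (posW f s n : ℝ) = SmW (fun b => ((f b).length : ℝ)) s n := by
  rw [posW, ← wtW_one, wtW_apply, smW_eq]
  simp only [wtW_one]

lemma wtW_le {φ ψ : X → ℝ} (h : ∀ b, φ b ≤ ψ b) (w : List X) : wtW φ w ≤ wtW ψ w :=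
  List.sum_le_sum (fun b _ => h b)

lemma wtW_mem_ge {φ : X → ℝ} (h : ∀ b, 0 ≤ φ b) {w : List X} {c : X} (hc : c ∈ w) :
    φ c ≤ wtW φ w := by
  apply List.single_le_sum
  · simp only [List.mem_map]; rintro y ⟨b, _, rfl⟩; exact h b
  · exact List.mem_map_of_mem hc

lemma wtW_sub (φ ψ : X → ℝ) (w : List X) : wtW (fun b => φ b - ψ b) w = wtW φ w - wtW ψ w := by
  induction w with
  | nil => simp [wtW]
  | cons a w ih => simp only [wtW, List.map_cons, List.sum_cons] at ih ⊢; rw [ih]; ring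

lemma wtW_mul (c : ℝ) (φ : X → ℝ) (w : List X) : wtW (fun b => c * φ b) w = c * wtW φ w := by
  induction w with
  | nil => simp [wtW]
  | cons a w ih => simp only [wtW, List.map_cons, List.sum_cons] at ih ⊢; rw [ih]; ring

lemma wtW_const (c : ℝ) (w : List X) : wtW (fun _ => c) w = c * w.length := by
  rw [← wtW_one, ← wtW_mul]; simp

/-- primitive morphisms live over a finite alphabet -/
lemma finite_of_prim {g : X → List X} (h : Primitive g) : Finite X := by
  obtain ⟨k, _, hk⟩ := h
  rcases isEmpty_or_nonempty X with hX | ⟨⟨b⟩⟩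
  · infer_instance
  · have : (Set.univ : Set X) ⊆ {a | a ∈ iterM g k [b]} := fun a _ => hk a b
    exact Set.finite_univ_iff.1 ((List.finite_toSet _).subset this)

lemma iterM_nil (g : X → List X) (k : ℕ) : iterM g k [] = [] := by
  rw [← applyM_powM]; simp [applyM]

lemma ne_nil_of_prim {g : X → List X} (h : Primitive g) (a : X) : g a ≠ [] := by
  obtain ⟨k, hk0, hk⟩ := h
  intro e
  have := hk a a
  obtain ⟨k, rfl⟩ := Nat.exists_eq_succ_of_ne_zero hk0.ne'
  rw [iterM, Function.iterate_succ_apply, applyM_single, e] at this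
  change a ∈ iterM g k [] at this
  rw [iterM_nil] at this
  simp at this

lemma length_le_apply {g : X → List X} (hne : ∀ a, g a ≠ []) (w : List X) :
    w.length ≤ (applyM g w).length := by
  induction w with
  | nil => simp
  | cons a w ih =>
    have := List.length_pos_iff.2 (hne a)
    simp only [applyM, List.flatMap_cons, List.length_append, List.length_cons] at ih ⊢
    omega

lemma pow_ne_nil {g : X → List X} (hne : ∀ a, g a ≠ []) (k : ℕ) (a : X) : powM g k a ≠ [] := by
  induction k with
  | zero => simp [powM, iterM]
  | succ k ih =>
    rw [add_comm, powM_add]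
    have h1 := length_le_apply (g := powM g 1) (by
      intro b; simpa [powM, iterM, applyM_single] using hne b) (powM g k a)
    have h2 := List.length_pos_iff.2 ih
    exact List.length_pos_iff.1 (by omega)

lemma compM_ne_nil {g f : X → List X} (hg : ∀ a, g a ≠ []) (hf : ∀ a, f a ≠ []) (a : X) :
    compM g f a ≠ [] := by
  have h1 := length_le_apply hg (f a)
  have h2 := List.length_pos_iff.2 (hf a)
  exact List.length_pos_iff.1 (lt_of_lt_of_le h2 h1)

lemma bound_exists [Finite X] (φ : X → ℝ) : ∃ M : ℝ, 0 < M ∧ ∀ a, |φ a| ≤ M := by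
  obtain ⟨M, hM⟩ := (Set.finite_range fun a => |φ a|).bddAbove
  exact ⟨max M 1, by positivity, fun a => le_max_of_le_left (hM ⟨a, rfl⟩)⟩

lemma len_bound_exists [Finite X] (f : X → List X) : ∃ M : ℕ, 0 < M ∧ ∀ a, (f a).length ≤ M := by
  obtain ⟨M, hM⟩ := (Set.finite_range fun a => (f a).length).bddAbove
  exact ⟨max M 1, by positivity, fun a => le_max_of_le_left (hM ⟨a, rfl⟩)⟩

lemma apply_length_le {f : X → List X} {M : ℕ} (h : ∀ a, (f a).length ≤ M) (w : List X) :
    (applyM f w).length ≤ M * w.length := by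
  induction w with
  | nil => simp [applyM]
  | cons a w ih =>
    have := h a
    simp only [applyM, List.flatMap_cons, List.length_append, List.length_cons] at ih ⊢
    rw [mul_add]; omega

lemma mem_length_le {f : X → List X} {w : List X} {c : X} (hc : c ∈ w) :
    (f c).length ≤ (applyM f w).length := by
  obtain ⟨u, v, rfl⟩ := List.append_of_mem hc
  simp [applyM]; omega

lemma length_compar [Finite X] {g : X → List X} (hp : Primitive g) :
    ∃ C : ℕ, 0 < C ∧ ∀ k b c, (powM g k b).length ≤ C * (powM g k c).length := by
  have hne := ne_nil_of_prim hp
  obtain ⟨m, hm, hmem⟩ := hp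
  obtain ⟨M, hM0, hM⟩ := len_bound_exists (powM g m)
  refine ⟨M, hM0, fun k b c => ?_⟩
  rcases le_total k m with h | h
  · obtain ⟨j, rfl⟩ := Nat.exists_eq_add_of_le h
    have h1 := hM b
    rw [add_comm k j, powM_add] at h1
    have h2 := length_le_apply (pow_ne_nil hne j) (powM g k b)
    have h3 := List.length_pos_iff.2 (pow_ne_nil hne k c)
    calc _ ≤ M * 1 := by omega
      _ ≤ _ := Nat.mul_le_mul_left _ h3
  · obtain ⟨j, rfl⟩ := Nat.exists_eq_add_of_le h
    calc (powM g (m + j) b).length ≤ M * (powM g j b).length := by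
          rw [powM_add]; exact apply_length_le hM _
      _ ≤ M * (powM g (m + j) c).length := by
          apply Nat.mul_le_mul_left
          rw [add_comm m j, powM_add]
          exact mem_length_le (hmem b c)

lemma wtW_powM_add (φ : X → ℝ) (g : X → List X) (k m : ℕ) (b : X) :
    wtW φ (powM g (k + m) b) = wtW (fun c => wtW φ (powM g k c)) (powM g m b) := by
  rw [powM_add, wtW_apply]

lemma wtW_nonneg {φ : X → ℝ} (h : ∀ b, 0 ≤ φ b) (w : List X) : 0 ≤ wtW φ w := by
  have := wtW_le h w
  rw [wtW_const] at this
  simpa using this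

lemma wtW_pow_mono {ψ : X → ℝ} {g : X → List X} {k : ℕ}
    (h : ∀ b, 0 ≤ wtW ψ (powM g k b)) (j : ℕ) (b : X) : 0 ≤ wtW ψ (powM g (k + j) b) := by
  rw [wtW_powM_add]
  exact wtW_nonneg h _

lemma improve {ψ : X → ℝ} {g : X → List X} {k m : ℕ} {C : ℝ} (hC : 0 < C)
    (hmem : ∀ a b : X, a ∈ powM g m b)
    (hlen : ∀ b c, ((powM g (k + m) b).length : ℝ) ≤ C * (powM g k c).length)
    (h : ∀ b, 0 ≤ wtW ψ (powM g k b)) {η : ℝ} (hη : 0 ≤ η) {c : X}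
    (hc : η * (powM g k c).length ≤ wtW ψ (powM g k c)) (b : X) :
    η / C * (powM g (k + m) b).length ≤ wtW ψ (powM g (k + m) b) := by
  have h1 : wtW ψ (powM g k c) ≤ wtW ψ (powM g (k + m) b) := by
    rw [wtW_powM_add]
    exact wtW_mem_ge (φ := fun c => wtW ψ (powM g k c)) h (hmem c b)
  refine le_trans ?_ (hc.trans h1)
  rw [div_mul_eq_mul_div, div_le_iff₀ hC, mul_assoc, mul_comm _ C]
  exact mul_le_mul_of_nonneg_left (hlen b c) hη

lemma wtW_sub_const (φ : X → ℝ) (a : ℝ) (w : List X) :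
    wtW (fun b => φ b - a) w = wtW φ w - a * w.length := by
  rw [wtW_sub φ (fun _ => a), wtW_const]

lemma wtW_const_sub (φ : X → ℝ) (a : ℝ) (w : List X) :
    wtW (fun b => a - φ b) w = a * w.length - wtW φ w := by
  rw [wtW_sub (fun _ => a) φ, wtW_const]

/-- Letter weights have asymptotically constant density in the images of letters. -/
lemma narrow [Finite X] {g : X → List X} (hp : Primitive g) (x : X) (φ : X → ℝ) (ε : ℝ)
    (hε : 0 < ε) : ∃ a A : ℝ, ∃ k : ℕ, A - a ≤ ε ∧
      (∀ b, 0 ≤ wtW (fun c => φ c - a) (powM g k b)) ∧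
      (∀ b, 0 ≤ wtW (fun c => A - φ c) (powM g k b)) := by
  have hne := ne_nil_of_prim hp
  obtain ⟨C₀, hC₀, hcomp⟩ := length_compar hp
  obtain ⟨m, hm, hmem⟩ := hp
  obtain ⟨M, hM0, hM⟩ := len_bound_exists (powM g m)
  obtain ⟨B, hB0, hB⟩ := bound_exists φ
  set C : ℝ := (M : ℝ) * C₀ with hCdef
  have hC1 : 1 ≤ C := by
    rw [hCdef]; exact_mod_cast Nat.mul_pos hM0 hC₀
  have hC : 0 < C := by linarith
  have hlen : ∀ k b c, ((powM g (k + m) b).length : ℝ) ≤ C * (powM g k c).length := by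
    intro k b c
    rw [hCdef]
    have : (powM g (k + m) b).length ≤ M * C₀ * (powM g k c).length := by
      rw [add_comm, powM_add, mul_assoc]
      exact (apply_length_le hM _).trans (Nat.mul_le_mul_left _ (hcomp k b c))
    exact_mod_cast this
  set θ : ℝ := 1 - 1 / (2 * C) with hθ
  have hθ1 : θ < 1 := by
    have : 0 < 1 / (2 * C) := by positivity
    linarith
  have hθ0 : 0 ≤ θ := by
    have : 1 / (2 * C) ≤ 1 := by rw [div_le_one (by positivity)]; linarith
    linarith
  have key : ∀ n : ℕ, ∃ a A : ℝ, ∃ k : ℕ, A - a ≤ θ ^ n * (2 * B) ∧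
      (∀ b, 0 ≤ wtW (fun c => φ c - a) (powM g k b)) ∧
      (∀ b, 0 ≤ wtW (fun c => A - φ c) (powM g k b)) := by
    intro n
    induction n with
    | zero =>
      refine ⟨-B, B, 0, by simp; linarith, fun b => wtW_nonneg (fun c => ?_) _,
        fun b => wtW_nonneg (fun c => ?_) _⟩
      · have := (abs_le.1 (hB c)).1; linarith
      · have := (abs_le.1 (hB c)).2; linarith
    | succ n ih =>
      obtain ⟨a, A, k, hAa, h1, h2⟩ := ih
      have hl : (0 : ℝ) < (powM g k x).length := by
        exact_mod_cast List.length_pos_iff.2 (pow_ne_nil hne k x)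
      have e1 := h1 x
      have e2 := h2 x
      rw [wtW_sub_const] at e1
      rw [wtW_const_sub] at e2
      have haA : a ≤ A := by
        by_contra hc
        push Not at hc
        have := mul_lt_mul_of_pos_right hc hl
        linarith
      have hη : 0 ≤ (A - a) / 2 := by linarith
      have hw : A - a - (A - a) / 2 / C = θ * (A - a) := by
        rw [hθ]; field_simp
      have hfin : θ * (A - a) ≤ θ ^ (n + 1) * (2 * B) := by
        rw [pow_succ', mul_assoc]; exact mul_le_mul_of_nonneg_left hAa hθ0
      rcases le_total ((a + A) / 2 * (powM g k x).length) (wtW φ (powM g k x)) with hh | hh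
      · refine ⟨a + (A - a) / 2 / C, A, k + m, by linarith, fun b => ?_, wtW_pow_mono h2 m⟩
        have := improve hC hmem (hlen k) h1 hη (c := x) (by rw [wtW_sub_const]; linarith) b
        rw [wtW_sub_const] at this ⊢
        linarith
      · refine ⟨a, A - (A - a) / 2 / C, k + m, by linarith, wtW_pow_mono h1 m, fun b => ?_⟩
        have := improve hC hmem (hlen k) h2 hη (c := x) (by rw [wtW_const_sub]; linarith) b
        rw [wtW_const_sub] at this ⊢
        linarith
  obtain ⟨n, hn⟩ := exists_pow_lt_of_lt_one (show 0 < ε / (2 * B) by positivity) hθ1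
  obtain ⟨a, A, k, h, h'⟩ := key n
  refine ⟨a, A, k, h.trans ?_, h'⟩
  rw [lt_div_iff₀ (by positivity)] at hn
  exact hn.le

lemma smW_add (φ : X → ℝ) (s : ℕ → X) (n l : ℕ) :
    SmW φ s (n + l) = SmW φ s n + ∑ i ∈ Finset.range l, φ (s (n + i)) := by
  simp [SmW, Finset.sum_range_add]

lemma smW_diff {φ : X → ℝ} {M : ℝ} (hM : ∀ a, |φ a| ≤ M) (s : ℕ → X) (n l : ℕ) :
    |SmW φ s (n + l) - SmW φ s n| ≤ M * l := by
  rw [smW_add, add_sub_cancel_left]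
  refine (Finset.abs_sum_le_sum_abs _ _).trans ?_
  refine (Finset.sum_le_sum (fun i _ => hM _)).trans ?_
  simp [mul_comm]

lemma smW_lower [Finite X] {g : X → List X} {s : ℕ → X} (hne : ∀ a, g a ≠ []) (hf : FixW g s)
    {ψ : X → ℝ} {k : ℕ} (h : ∀ b, 0 ≤ wtW ψ (powM g k b)) :
    ∃ K : ℝ, 0 < K ∧ ∀ n, -K ≤ SmW ψ s n := by
  obtain ⟨B, hB0, hB⟩ := bound_exists ψ
  obtain ⟨M, hM0, hM⟩ := len_bound_exists (powM g k)
  refine ⟨B * M, by positivity, fun N => ?_⟩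
  obtain ⟨n, h1, h2⟩ := posW_locate (pow_ne_nil hne k) s N
  rw [posW_succ] at h2
  obtain ⟨l, rfl⟩ := Nat.exists_eq_add_of_le h1
  have hl : (l : ℝ) ≤ M := by exact_mod_cast (by have := hM (s n); omega)
  have e := (abs_le.1 (smW_diff hB s (posW (powM g k) s n) l)).1
  have e2 : 0 ≤ SmW ψ s (posW (powM g k) s n) := by
    rw [smW_pos (fix_pow hf k)]
    exact Finset.sum_nonneg (fun i _ => h _)
  have : B * l ≤ B * M := mul_le_mul_of_nonneg_left hl hB0.le
  linarith

lemma smW_sub_const (φ : X → ℝ) (a : ℝ) (s : ℕ → X) (n : ℕ) :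
    SmW (fun b => φ b - a) s n = SmW φ s n - a * n := by
  rw [smW_eq, smW_eq, wtW_sub_const, facW_length]

lemma smW_const_sub (φ : X → ℝ) (a : ℝ) (s : ℕ → X) (n : ℕ) :
    SmW (fun b => a - φ b) s n = a * n - SmW φ s n := by
  rw [smW_eq, smW_eq, wtW_const_sub, facW_length]

lemma dens_lower [Finite X] {g : X → List X} {s : ℕ → X} (hne : ∀ a, g a ≠ []) (hf : FixW g s)
    {φ : X → ℝ} {a : ℝ} {k : ℕ} (h : ∀ b, 0 ≤ wtW (fun c => φ c - a) (powM g k b))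
    {η : ℝ} (hη : 0 < η) : ∀ᶠ n : ℕ in atTop, a - η ≤ SmW φ s n / n := by
  obtain ⟨K, hK, hh⟩ := smW_lower hne hf h
  obtain ⟨N, hN⟩ := exists_nat_gt (K / η)
  filter_upwards [eventually_ge_atTop (N + 1)] with n hn
  have hn0 : (0 : ℝ) < n := by exact_mod_cast (by omega)
  have := hh n
  rw [smW_sub_const] at this
  rw [le_div_iff₀ hn0]
  rw [div_lt_iff₀ hη] at hN
  have : (N : ℝ) ≤ n := by exact_mod_cast (by omega)
  have := mul_le_mul_of_nonneg_right this hη.le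
  linarith

lemma dens_upper [Finite X] {g : X → List X} {s : ℕ → X} (hne : ∀ a, g a ≠ []) (hf : FixW g s)
    {φ : X → ℝ} {a : ℝ} {k : ℕ} (h : ∀ b, 0 ≤ wtW (fun c => a - φ c) (powM g k b))
    {η : ℝ} (hη : 0 < η) : ∀ᶠ n : ℕ in atTop, SmW φ s n / n ≤ a + η := by
  obtain ⟨K, hK, hh⟩ := smW_lower hne hf h
  obtain ⟨N, hN⟩ := exists_nat_gt (K / η)
  filter_upwards [eventually_ge_atTop (N + 1)] with n hn
  have hn0 : (0 : ℝ) < n := by exact_mod_cast (by omega)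
  have := hh n
  rw [smW_const_sub] at this
  rw [div_le_iff₀ hn0]
  rw [div_lt_iff₀ hη] at hN
  have : (N : ℝ) ≤ n := by exact_mod_cast (by omega)
  have := mul_le_mul_of_nonneg_right this hη.le
  linarith

lemma dens_exists [Finite X] {g : X → List X} {s : ℕ → X} (hp : Primitive g) (hf : FixW g s)
    (φ : X → ℝ) : ∃ μ : ℝ, Tendsto (fun n : ℕ => SmW φ s n / n) atTop (nhds μ) := by
  apply cauchySeq_tendsto_of_complete
  rw [Metric.cauchySeq_iff']
  intro ε hε
  have hne := ne_nil_of_prim hp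
  obtain ⟨a, A, k, hAa, h1, h2⟩ := narrow hp (s 0) φ (ε / 4) (by positivity)
  obtain ⟨N, hN⟩ := eventually_atTop.1
    ((dens_lower hne hf h1 (η := ε / 4) (by positivity)).and
      (dens_upper hne hf h2 (η := ε / 4) (by positivity)))
  refine ⟨N, fun n hn => ?_⟩
  have e1 := hN n hn
  have e2 := hN N le_rfl
  rw [Real.dist_eq, abs_lt]
  constructor <;> linarith [e1.1, e1.2, e2.1, e2.2]

lemma small_of_dens_zero [Finite X] {g : X → List X} {s : ℕ → X} (hp : Primitive g)
    (hf : FixW g s) (φ : X → ℝ)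
    (h0 : Tendsto (fun n : ℕ => SmW φ s n / n) atTop (nhds 0)) {ε : ℝ} (hε : 0 < ε) :
    ∃ k₀, ∀ k ≥ k₀, ∀ b, |wtW φ (powM g k b)| ≤ ε * (powM g k b).length := by
  have hne := ne_nil_of_prim hp
  obtain ⟨a, A, k, hAa, h1, h2⟩ := narrow hp (s 0) φ ε hε
  have ha : a ≤ 0 := by
    apply le_of_forall_pos_le_add
    intro η hη
    have := ge_of_tendsto h0 (dens_lower hne hf h1 hη)
    linarith
  have hA : 0 ≤ A := by
    apply le_of_forall_pos_le_add
    intro η hη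
    exact le_of_tendsto h0 (dens_upper hne hf h2 hη)
  refine ⟨k, fun k' hk b => ?_⟩
  obtain ⟨j, rfl⟩ := Nat.exists_eq_add_of_le hk
  have e1 := wtW_pow_mono h1 j b
  have e2 := wtW_pow_mono h2 j b
  rw [wtW_sub_const] at e1
  rw [wtW_const_sub] at e2
  have hl : (0 : ℝ) ≤ (powM g (k + j) b).length := by positivity
  rw [abs_le]
  constructor <;> nlinarith

/-- The two compositions have the same growth along `s`. -/
lemma dens_comm [Finite X] {g₁ g₂ : X → List X} {s : ℕ → X} (hp₁ : Primitive g₁)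
    (hp₂ : Primitive g₂) (hf₁ : FixW g₁ s) (hf₂ : FixW g₂ s) :
    Tendsto (fun n : ℕ => SmW (fun b => ((compM g₁ g₂ b).length : ℝ) - (compM g₂ g₁ b).length) s n
      / n) atTop (nhds 0) := by
  obtain ⟨μ₁, h₁⟩ := dens_exists hp₁ hf₁ (fun b => ((g₁ b).length : ℝ))
  obtain ⟨μ₂, h₂⟩ := dens_exists hp₁ hf₁ (fun b => ((g₂ b).length : ℝ))
  have key : ∀ (f h : X → List X) (μ ν : ℝ), (∀ a, h a ≠ []) → FixW h s →
      Tendsto (fun n : ℕ => SmW (fun b => ((f b).length : ℝ)) s n / n) atTop (nhds μ) →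
      Tendsto (fun n : ℕ => SmW (fun b => ((h b).length : ℝ)) s n / n) atTop (nhds ν) →
      Tendsto (fun n : ℕ => SmW (fun b => ((compM f h b).length : ℝ)) s n / n) atTop
        (nhds (μ * ν)) := by
    intro f h μ ν hne hh t1 t2
    have hm := posW_strictMono hne s
    have := (t1.comp hm.tendsto_atTop).mul t2
    refine this.congr' ?_
    filter_upwards [eventually_ge_atTop 1] with n hn
    have hp0 : (posW h s n : ℝ) ≠ 0 := by
      have : n ≤ posW h s n := hm.id_le n
      exact_mod_cast (by omega)
    simp only [Function.comp]
    rw [smW_pos hh, ← posW_eq_smW h]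
    have : (fun b => wtW (fun b => ((f b).length : ℝ)) (h b)) =
        fun b => ((compM f h b).length : ℝ) := by
      funext b
      rw [compM, ← wtW_one, wtW_apply]
      simp only [wtW_one]
    rw [this]
    field_simp
  have k1 := key g₁ g₂ _ _ (ne_nil_of_prim hp₂) hf₂ h₁ h₂
  have k2 := key g₂ g₁ _ _ (ne_nil_of_prim hp₁) hf₁ h₂ h₁
  have := k1.sub k2
  rw [mul_comm μ₂, sub_self] at this
  refine this.congr (fun n => ?_)
  rw [← sub_div]
  simp [SmW, Finset.sum_sub_distrib]

lemma gapW [Finite X] {g : X → List X} {s : ℕ → X} (hp : Primitive g) (hf : FixW g s) :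
    ∃ R : ℕ, 0 < R ∧ ∀ n, ∃ n', n' ≤ n ∧ n ≤ n' + R ∧ s n' = s 0 := by
  have hne := ne_nil_of_prim hp
  obtain ⟨m, hm, hmem⟩ := hp
  obtain ⟨M, hM0, hM⟩ := len_bound_exists (powM g m)
  refine ⟨2 * M, by omega, fun N => ?_⟩
  obtain ⟨n, h1, h2⟩ := posW_locate (pow_ne_nil hne m) s N
  have hs := posW_succ (powM g m) s n
  have hb := hM (s n)
  rcases n with _ | n
  · rw [posW_zero] at *
    exact ⟨0, by omega, by omega, rfl⟩
  · have hs' := posW_succ (powM g m) s n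
    have hb' := hM (s n)
    obtain ⟨t, ht, e⟩ := List.getElem_of_mem (hmem (s 0) (s n))
    change t < (powM g m (s n)).length at ht
    have := fix_facW (fix_pow hf m) n 1
    rw [facW_one, applyM_single] at this
    have e2 : (powM g m (s n))[t]? = some (s 0) := by
      rw [List.getElem?_eq_getElem ht]; exact congrArg some e
    rw [this] at e2
    simp [FacW, ht] at e2
    exact ⟨posW (powM g m) s n + t, by omega, by omega, e2⟩

lemma growW [Finite X] {g : X → List X} {x : X} {s : ℕ → X} (hp : Primitive g)
    (ho : IsOmega g x s) :
    ∃ C : ℕ, 0 < C ∧ ∀ q > 0, ∃ k, ∀ b, q ≤ (powM g k b).length ∧ (powM g k b).length ≤ C * q := by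
  classical
  obtain ⟨C₀, hC₀, hcomp⟩ := length_compar hp
  obtain ⟨M, hM0, hM⟩ := len_bound_exists (powM g 1)
  refine ⟨M * C₀, by positivity, fun q hq => ?_⟩
  have hex : ∃ k, ∀ b, q ≤ (powM g k b).length := by
    obtain ⟨k, hk⟩ := (ho.1.2.eventually_ge_atTop (C₀ * q)).exists
    refine ⟨k, fun b => ?_⟩
    exact Nat.le_of_mul_le_mul_left (hk.trans (hcomp k x b)) hC₀
  refine ⟨Nat.find hex, fun b => ⟨Nat.find_spec hex b, ?_⟩⟩
  rcases hk : Nat.find hex with _ | k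
  · have : (powM g 0 b).length = 1 := by simp [powM, iterM]
    rw [this]
    have : 0 < M * C₀ * q := by positivity
    omega
  · have := Nat.find_min hex (m := k) (by omega)
    push Not at this
    obtain ⟨c, hc⟩ := this
    rw [add_comm, powM_add]
    refine (apply_length_le hM _).trans ?_
    rw [mul_assoc]
    exact Nat.mul_le_mul_left _ ((hcomp k b c).trans (Nat.mul_le_mul_left _ hc.le))

/-- A long prefix with a short period forces periodicity. -/
lemma power_free [Finite X] {g : X → List X} {x : X} {s : ℕ → X} (hp : Primitive g)
    (ho : IsOmega g x s) :
    ∃ C : ℕ, 0 < C ∧ ∀ q > 0, (∀ i, i + q < C * q → s (i + q) = s i) → ∀ i, s (i + q) = s i := by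
  have hf := fix_of_omega ho
  have hne := ne_nil_of_prim hp
  have hR : ∃ R : ℕ, ∀ i, ∃ i', i' ≤ R ∧ s i' = s i ∧ s (i' + 1) = s (i + 1) := by
    have h : ∀ p : X × X, ∃ r : ℕ, ∀ i, (s i, s (i + 1)) = p →
        ∃ i', i' ≤ r ∧ (s i', s (i' + 1)) = p := by
      intro p
      by_cases hh : ∃ i, (s i, s (i + 1)) = p
      · obtain ⟨i, hi⟩ := hh
        exact ⟨i, fun _ _ => ⟨i, le_rfl, hi⟩⟩
      · exact ⟨0, fun i hi => absurd ⟨i, hi⟩ hh⟩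
    choose r hr using h
    obtain ⟨R, hR⟩ := (Set.finite_range r).bddAbove
    refine ⟨R, fun i => ?_⟩
    obtain ⟨i', h1, h2⟩ := hr _ i rfl
    exact ⟨i', h1.trans (hR ⟨_, rfl⟩), (Prod.ext_iff.1 h2).1, (Prod.ext_iff.1 h2).2⟩
  obtain ⟨R, hR⟩ := hR
  obtain ⟨C, hC, hgrow⟩ := growW hp ho
  refine ⟨C * (R + 2), by positivity, fun q hq hper i => ?_⟩
  obtain ⟨k, hk⟩ := hgrow q hq
  obtain ⟨n, h1, h2⟩ := posW_locate (pow_ne_nil hne k) s i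
  obtain ⟨n', hn', e1, e2⟩ := hR n
  have hs := posW_succ (powM g k) s n
  have hs2 := posW_succ (powM g k) s (n + 1)
  have hadd := posW_add (powM g k) s n 2
  have agree := fix_agree (fix_pow hf k) (i := n) (j := n') (l := 2) (by
    intro t ht
    interval_cases t
    · exact e1.symm
    · exact e2.symm)
  obtain ⟨t, rfl⟩ := Nat.exists_eq_add_of_le h1
  have hb1 := (hk (s n)).1
  have hb2 := (hk (s (n + 1))).1
  have hlen : (applyM (powM g k) (FacW s n 2)).length =
      (powM g k (s n)).length + (powM g k (s (n + 1))).length := by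
    change posW (powM g k) s (n + 1 + 1) = _ at hadd
    omega
  have a1 := agree t (by omega)
  have a2 := agree (t + q) (by omega)
  rw [add_assoc, a1, a2, ← add_assoc]
  apply hper
  have s1 := posW_succ (powM g k) s n'
  have s2 := posW_succ (powM g k) s (n' + 1)
  rw [e1] at s1
  rw [e2] at s2
  have hle : posW (powM g k) s (n' + 1 + 1) ≤ (C * q) * (n' + 1 + 1) := by
    have := apply_length_le (fun a => (hk a).2) (FacW s 0 (n' + 1 + 1))
    rwa [facW_length] at this
  have hle2 : (C * q) * (n' + 1 + 1) ≤ (C * q) * (R + 2) := Nat.mul_le_mul_left _ (by omega)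
  have : C * (R + 2) * q = (C * q) * (R + 2) := by ring
  omega

lemma shift_period {f h : X → List X} {s : ℕ → X} (hf : FixW f s) (hh : FixW h s)
    (hfn : ∀ a, f a ≠ []) (hhn : ∀ a, h a ≠ []) {j L q : ℕ}
    (hj : ∀ t, t < L → s (j + t) = s (0 + t)) (hq : posW f s j = posW h s j + q)
    (i : ℕ) (hi : i + q < L) : s (i + q) = s i := by
  have l1 := length_le_apply hfn (FacW s j L)
  have l2 := length_le_apply hhn (FacW s j L)
  rw [facW_length] at l1 l2
  have a1 := fix_agree hf hj i (by omega)
  have a2 := fix_agree hh hj (i + q) (by omega)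
  rw [posW_zero, zero_add] at a1 a2
  rw [← a1, ← a2, hq]
  congr 1; omega

lemma smW_delta (f h : X → List X) (s : ℕ → X) (n : ℕ) :
    SmW (fun b => ((f b).length : ℝ) - (h b).length) s n = (posW f s n : ℝ) - posW h s n := by
  rw [posW_eq_smW, posW_eq_smW]
  simp [SmW, Finset.sum_sub_distrib]

lemma bounded_aperiodic [Finite X] {g f h : X → List X} {x : X} {s : ℕ → X} (hp : Primitive g)
    (ho : IsOmega g x s) (hf : FixW f s) (hh : FixW h s)
    (hfn : ∀ a, f a ≠ []) (hhn : ∀ a, h a ≠ [])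
    (h0 : Tendsto (fun n : ℕ => SmW (fun b => ((f b).length : ℝ) - (h b).length) s n / n)
      atTop (nhds 0))
    (hap : ¬ ∃ q > 0, ∀ i, s (i + q) = s i) :
    ∃ K : ℝ, ∀ n, |SmW (fun b => ((f b).length : ℝ) - (h b).length) s n| ≤ K := by
  have hg := fix_of_omega ho
  have hne := ne_nil_of_prim hp
  set δ : X → ℝ := fun b => ((f b).length : ℝ) - (h b).length with hδ
  obtain ⟨C, hC, hpf⟩ := power_free hp ho
  obtain ⟨R, hR, hgap⟩ := gapW hp hg
  obtain ⟨C₁, hC₁, hcomp⟩ := length_compar hp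
  obtain ⟨k, hk⟩ := small_of_dens_zero hp hg δ h0
    (ε := 1 / ((R + 1 : ℕ) * C₁ * C)) (by positivity)
  replace hk := hk k le_rfl
  set G := powM g k with hG
  have hGf : FixW G s := fix_pow hg k
  have hGn : ∀ a, G a ≠ [] := pow_ne_nil hne k
  set L := (G (s 0)).length with hL
  have hE : ∀ b, |wtW δ (G b)| ≤ (L : ℝ) / ((R + 1 : ℕ) * C) := by
    intro b
    refine (hk b).trans ?_
    have : ((G b).length : ℝ) ≤ C₁ * L := by exact_mod_cast hcomp k b (s 0)
    calc _ ≤ 1 / (((R + 1 : ℕ) : ℝ) * C₁ * C) * (C₁ * L) := by gcongr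
      _ = _ := by field_simp
  have hzero : ∀ n, s n = s 0 → C * |SmW δ s (posW G s n)| ≤ L → SmW δ s (posW G s n) = 0 := by
    intro n hn hle
    have hj : ∀ t, t < L → s (posW G s n + t) = s (0 + t) := by
      intro t ht
      have := fix_agree hGf (i := n) (j := 0) (l := 1) (by
        intro t ht
        interval_cases t
        exact hn) t (by rw [facW_one, applyM_single, hn]; exact ht)
      rwa [posW_zero] at this
    rw [smW_delta] at hle ⊢
    rcases lt_trichotomy (posW f s (posW G s n)) (posW h s (posW G s n)) with hlt | heq | hlt
    · exfalso
      obtain ⟨q, hq⟩ := Nat.exists_eq_add_of_le hlt.le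
      have hq0 : 0 < q := by omega
      apply hap
      refine ⟨q, hq0, hpf q hq0 (fun i hi => ?_)⟩
      rw [hq] at hle
      push_cast at hle
      rw [sub_add_cancel_left, abs_neg, abs_of_nonneg (by positivity)] at hle
      have hle' : C * q ≤ L := by exact_mod_cast hle
      exact shift_period hh hf hhn hfn hj hq i (by omega)
    · rw [heq]; ring
    · exfalso
      obtain ⟨q, hq⟩ := Nat.exists_eq_add_of_le hlt.le
      have hq0 : 0 < q := by omega
      apply hap
      refine ⟨q, hq0, hpf q hq0 (fun i hi => ?_)⟩
      rw [hq] at hle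
      push_cast at hle
      rw [add_sub_cancel_left, abs_of_nonneg (by positivity)] at hle
      have hle' : C * q ≤ L := by exact_mod_cast hle
      exact shift_period hf hh hfn hhn hj hq i (by omega)
  have hall : ∀ n, s n = s 0 → SmW δ s (posW G s n) = 0 := by
    intro n
    induction n using Nat.strong_induction_on with
    | _ n ih =>
      intro hn
      rcases n with _ | n
      · rw [posW_zero]; simp [SmW]
      · obtain ⟨n', h1, h2, h3⟩ := hgap n
        have e := ih n' (by omega) h3
        apply hzero _ hn
        rw [smW_pos hGf] at e ⊢
        obtain ⟨l, hl⟩ := Nat.exists_eq_add_of_le (show n' ≤ n + 1 by omega)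
        have hd := smW_diff hE s n' l
        rw [← hl, e, sub_zero] at hd
        have hlR : (l : ℝ) ≤ (R + 1 : ℕ) := by exact_mod_cast (by omega)
        calc _ ≤ (C : ℝ) * ((L : ℝ) / ((R + 1 : ℕ) * C) * (R + 1 : ℕ)) := by
              gcongr
              exact hd.trans (by gcongr)
          _ = L := by field_simp
  obtain ⟨B, hB0, hB⟩ := bound_exists δ
  obtain ⟨M, hM0, hM⟩ := len_bound_exists G
  refine ⟨B * (M * (R + 1) : ℕ), fun N => ?_⟩
  obtain ⟨n, h1, h2⟩ := posW_locate hGn s N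
  obtain ⟨n', g1, g2, g3⟩ := hgap n
  have hmono := (posW_strictMono hGn s).monotone g1
  obtain ⟨l, rfl⟩ := Nat.exists_eq_add_of_le (hmono.trans h1)
  have hd := smW_diff hB s (posW G s n') l
  rw [hall n' g3, sub_zero] at hd
  refine hd.trans ?_
  have : l ≤ M * (R + 1) := by
    obtain ⟨r, hr⟩ := Nat.exists_eq_add_of_le (show n' ≤ n + 1 by omega)
    rw [hr, posW_add] at h2
    have h4 := apply_length_le hM (FacW s n' r)
    rw [facW_length] at h4
    have h5 : M * r ≤ M * (R + 1) := Nat.mul_le_mul_left _ (by omega)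
    omega
  gcongr

lemma bounded_periodic [Finite X] {s : ℕ → X} {φ : X → ℝ}
    (h0 : Tendsto (fun n : ℕ => SmW φ s n / n) atTop (nhds 0))
    {q : ℕ} (hq : 0 < q) (hper : ∀ i, s (i + q) = s i) :
    ∃ K : ℝ, ∀ n, |SmW φ s n| ≤ K := by
  have hper' : ∀ n i, s (n * q + i) = s i := by
    intro n
    induction n with
    | zero => simp
    | succ n ih => intro i; rw [← ih i, ← hper (n * q + i)]; congr 1; ring
  have hadd : ∀ n t, SmW φ s (n * q + t) = SmW φ s (n * q) + SmW φ s t := by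
    intro n t
    rw [smW_add]; simp only [hper']; rfl
  have hmul : ∀ n : ℕ, SmW φ s (n * q) = n * SmW φ s q := by
    intro n
    induction n with
    | zero => simp [SmW]
    | succ n ih => rw [add_mul, one_mul, hadd, ih]; push_cast; ring
  have hq' : (q : ℝ) ≠ 0 := by exact_mod_cast hq.ne'
  have hz : SmW φ s q / q = 0 := by
    have ht : Tendsto (fun n : ℕ => n * q) atTop atTop :=
      tendsto_id.atTop_mul_const' hq
    have h1 := h0.comp ht
    have h2 : Tendsto (fun _ : ℕ => SmW φ s q / q) atTop (nhds 0) := by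
      refine h1.congr' ?_
      filter_upwards [eventually_ge_atTop 1] with n hn
      have : (n : ℝ) ≠ 0 := by exact_mod_cast (by omega)
      simp only [Function.comp, hmul]
      push_cast
      field_simp
    exact tendsto_nhds_unique tendsto_const_nhds h2
  have hz' : SmW φ s q = 0 := by
    rcases div_eq_zero_iff.1 hz with h | h
    · exact h
    · exact absurd h hq'
  obtain ⟨B, hB0, hB⟩ := bound_exists φ
  refine ⟨B * q, fun n => ?_⟩
  have e : n / q * q + n % q = n := Nat.div_add_mod' n q
  rw [← e, hadd, hmul, hz', mul_zero, zero_add]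
  have := smW_diff hB s 0 (n % q)
  have h00 : SmW φ s 0 = 0 := by simp [SmW]
  rw [zero_add, h00, sub_zero] at this
  refine this.trans ?_
  have : n % q ≤ q := (Nat.mod_lt _ hq).le
  gcongr

/-- Let `g₁, g₂` be primitive morphisms with
`g₁^ω(x) = g₂^ω(x) = s`.  If `g₁g₂` and `g₂g₁` are primitive, there is `K ≥ 1`
with `||g₁g₂(w)| - |g₂g₁(w)|| ≤ K` for every factor `w` of `g₁^ω(x)`. -/
theorem primitive_pair_balance_on_factors {X : Type*}
    (g₁ g₂ : X → List X) (hg₁ : Primitive g₁) (hg₂ : Primitive g₂)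
    (x : X) (s : ℕ → X) (h₁ : IsOmega g₁ x s) (h₂ : IsOmega g₂ x s)
    (hc₁ : Primitive (compM g₁ g₂)) (hc₂ : Primitive (compM g₂ g₁)) :
    ∃ K : ℕ, 0 < K ∧ ∀ w : List X, IsFactorI w s →
      (((applyM g₁ (applyM g₂ w)).length : ℤ) -
        ((applyM g₂ (applyM g₁ w)).length : ℤ)).natAbs ≤ K := by
  have := finite_of_prim hg₁
  have f₁ := fix_of_omega h₁
  have f₂ := fix_of_omega h₂
  have n₁ := ne_nil_of_prim hg₁
  have n₂ := ne_nil_of_prim hg₂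
  have h0 := dens_comm hg₁ hg₂ f₁ f₂
  obtain ⟨K, hK⟩ : ∃ K : ℝ, ∀ n,
      |SmW (fun b => ((compM g₁ g₂ b).length : ℝ) - (compM g₂ g₁ b).length) s n| ≤ K := by
    by_cases hper : ∃ q > 0, ∀ i, s (i + q) = s i
    · obtain ⟨q, hq, hp⟩ := hper
      exact bounded_periodic h0 hq hp
    · exact bounded_aperiodic hg₁ h₁ (fix_comp f₁ f₂) (fix_comp f₂ f₁)
        (compM_ne_nil n₁ n₂) (compM_ne_nil n₂ n₁) h0 hper
  obtain ⟨N, hN⟩ := exists_nat_ge (2 * K)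
  refine ⟨N + 1, by omega, fun w hw => ?_⟩
  obtain ⟨j, hj⟩ := hw
  have hwe : w = FacW s j w.length := by
    apply List.ext_getElem
    · simp [FacW]
    · intro i h1 h2
      simp [FacW, hj i h1]
  have a1 := hK j
  have a2 := hK (j + w.length)
  rw [smW_delta] at a1 a2
  rw [posW_add, posW_add, ← hwe] at a2
  rw [applyM_comp, applyM_comp]
  push_cast at a2
  have a3 : |((applyM (compM g₁ g₂) w).length : ℝ) - (applyM (compM g₂ g₁) w).length| ≤ N := by
    rw [abs_le] at a1 a2 ⊢
    constructor <;> linarith [a1.1, a1.2, a2.1, a2.2]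
  have a4 : |((applyM (compM g₁ g₂) w).length : ℤ) - (applyM (compM g₂ g₁) w).length| ≤ N := by
    exact_mod_cast a3
  rw [abs_le] at a4
  omega
end

section
/- Let X be an alphabet having n ≥ 2 letters. Let g, h: X* → X* be primitive morphisms and let x ∈ X be a letter such that g^ω(x) and h^ω(x) exist. Assume that g is looping and BAL(g, h) < ∞. Then g^ω(x) = h^ω(x) if and only if g^{2n}(x) ∈ COMP(g, h). -/
open Filter Set

variable {X : Type*}

/-- Two words commute. -/
def CommW {A : Type*} (a b : List A) : Prop := a ++ b = b ++ a

/-- A map between free monoids that is compatible with concatenation. -/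
def HomW {A B : Type*} (F : List A → List B) : Prop := ∀ u w, F (u ++ w) = F u ++ F w

namespace LoopAux

universe u

theorem CommW.symm {A : Type*} {a b : List A} (h : CommW a b) : CommW b a := Eq.symm h

theorem CommW.append {A : Type*} {a b c : List A} (h : CommW a c) (h' : CommW b c) :
    CommW (a ++ b) c := by
  unfold CommW at *
  rw [List.append_assoc, h', ← List.append_assoc, h, List.append_assoc]

theorem HomW.comm {A B : Type*} {F : List A → List B} (hF : HomW F) {a b : List A}
    (h : CommW a b) : CommW (F a) (F b) := by
  unfold CommW at *
  rw [← hF, ← hF, h]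

theorem HomW.mono {A B : Type*} {F : List A → List B} (hF : HomW F) {a b : List A}
    (h : a <+: b) : F a <+: F b := by
  obtain ⟨t, rfl⟩ := h
  exact ⟨F t, (hF _ _).symm⟩

theorem HomW.nil {A B : Type*} {F : List A → List B} (hF : HomW F) : F [] = [] := by
  have h := congrArg List.length (hF [] [])
  simp at h
  exact h

theorem homW_flatMap {A B : Type*} (g : A → List B) : HomW (fun w : List A => w.flatMap g) := by
  intro u w
  simp

theorem homW_apply {A : Type*} (g : A → List A) : HomW (applyM g) := homW_flatMap g

theorem homW_iter {A : Type*} (g : A → List A) (k : ℕ) : HomW (iterM g k) := by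
  induction k with
  | zero => intro u w; rfl
  | succ k ih =>
    intro u w
    have h : ∀ z, iterM g (k+1) z = applyM g (iterM g k z) := fun z =>
      Function.iterate_succ_apply' _ _ _
    rw [h, h, h, ih, homW_apply]

theorem iter_succ {A : Type*} (g : A → List A) (k : ℕ) (w : List A) :
    iterM g (k+1) w = applyM g (iterM g k w) := Function.iterate_succ_apply' _ _ _

theorem iter_succ' {A : Type*} (g : A → List A) (k : ℕ) (w : List A) :
    iterM g (k+1) w = iterM g k (applyM g w) := Function.iterate_succ_apply _ _ _

theorem iter_add {A : Type*} (g : A → List A) (j k : ℕ) (w : List A) :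
    iterM g (j+k) w = iterM g j (iterM g k w) := Function.iterate_add_apply _ _ _ _

theorem iter_zero {A : Type*} (g : A → List A) (w : List A) : iterM g 0 w = w := rfl

theorem apply_singleton {A : Type*} (g : A → List A) (a : A) : applyM g [a] = g a := by
  simp [applyM]

theorem prefix_of_comm {A : Type*} {a b : List A} (h : CommW a b) (hl : a.length ≤ b.length) :
    a <+: b := by
  have h1 : a <+: b ++ a := ⟨b, h⟩
  exact List.prefix_of_prefix_length_le h1 (List.prefix_append _ _) hl

theorem long_comm {A : Type*} {b : List A} (hb : b ≠ []) (N : ℕ) :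
    ∃ B : List A, N ≤ B.length ∧ ∀ a, CommW a b → CommW a B := by
  induction N with
  | zero => exact ⟨b, Nat.zero_le _, fun a h => h⟩
  | succ N ih =>
    obtain ⟨B, h1, h2⟩ := ih
    refine ⟨B ++ b, ?_, fun a h => ?_⟩
    · have := List.length_pos_iff.2 hb
      simp; omega
    · exact (CommW.append (h2 a h).symm h.symm).symm

theorem comm_trans_aux {A : Type*} {b : List A} (hb : b ≠ []) (N : ℕ) :
    ∀ a c : List A, a.length + c.length ≤ N → CommW a b → CommW c b → CommW a c := by
  induction N with
  | zero =>
    intro a c h _ _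
    have ha : a = [] := List.length_eq_zero_iff.1 (by omega)
    have hc : c = [] := List.length_eq_zero_iff.1 (by omega)
    subst ha; subst hc; rfl
  | succ N ih =>
    have key : ∀ a c : List A, a.length + c.length ≤ N+1 → a.length ≤ c.length →
        CommW a b → CommW c b → CommW a c := by
      intro a c h hl hab hcb
      by_cases ha : a = []
      · subst ha; simp [CommW]
      have hap := List.length_pos_iff.2 ha
      obtain ⟨B, hB, hB'⟩ := long_comm hb (a.length + c.length)
      have h1 : a <+: B := prefix_of_comm (hB' a hab) (by omega)
      have h2 : c <+: B := prefix_of_comm (hB' c hcb) (by omega)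
      obtain ⟨d, rfl⟩ := List.prefix_of_prefix_length_le h1 h2 hl
      have hd : CommW d b := by
        unfold CommW at *
        have h3 : a ++ (d ++ b) = a ++ (b ++ d) := by
          rw [← List.append_assoc, hcb, ← List.append_assoc, ← hab, List.append_assoc]
        exact List.append_cancel_left h3
      have h4 : CommW a d := ih a d (by simp at h; omega) hab hd
      exact (CommW.append (show CommW a a from rfl) h4.symm).symm
    intro a c h hab hcb
    rcases le_total a.length c.length with hl | hl
    · exact key a c h hl hab hcb
    · exact (key c a (by omega) hl hcb hab).symm

theorem comm_trans {A : Type*} {a b c : List A} (hb : b ≠ []) (h1 : CommW a b)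
    (h2 : CommW b c) : CommW a c :=
  comm_trans_aux hb _ a c le_rfl h1 h2.symm

/-- Rotation. -/
theorem comm_rotate {A : Type*} (s : List A) : ∀ (r c : List A), CommW c (s ++ r) →
    ∃ c', c'.length = c.length ∧ CommW c' (r ++ s) := by
  induction s with
  | nil => intro r c h; exact ⟨c, rfl, by simpa using h⟩
  | cons a l ih =>
    intro r c h
    cases c with
    | nil => exact ⟨[], rfl, by simp [CommW]⟩
    | cons b c0 =>
      unfold CommW at h
      simp at h
      obtain ⟨rfl, h⟩ := h
      have h' : CommW (c0 ++ [b]) (l ++ (r ++ [b])) := by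
        unfold CommW
        have := congrArg (fun z => z ++ [b]) h
        simpa using this
      obtain ⟨c', h1, h2⟩ := ih _ _ h'
      exact ⟨c', by simpa using h1, by simpa using h2⟩

theorem occ_lemma {A : Type*} {q Z : List A} (hq : q ≠ []) (hZ : CommW Z q) (N : ℕ) :
    ∀ y : List A, y.length ≤ N → y ++ q <+: Z →
      CommW y q ∨ ∃ c, c ≠ [] ∧ c.length < q.length ∧ CommW c q := by
  induction N with
  | zero =>
    intro y hy _
    have : y = [] := List.length_eq_zero_iff.1 (by omega)
    subst this
    left; simp [CommW]
  | succ N ih =>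
    intro y hy hp
    have hqp := List.length_pos_iff.2 hq
    have hyZ : y <+: Z := (List.prefix_append _ _).trans hp
    have hqZ : q <+: Z := prefix_of_comm hZ.symm (by
      have := hp.length_le
      simp at this; omega)
    rcases lt_or_ge y.length q.length with hl | hl
    · obtain ⟨q2, rfl⟩ := List.prefix_of_prefix_length_le hyZ hqZ hl.le
      left
      have h1 : y ++ (y ++ q2) <+: y ++ (q2 ++ Z) := by
        have : y ++ (q2 ++ Z) = Z ++ (y ++ q2) := by
          rw [← List.append_assoc]; exact hZ.symm
        rw [this]
        exact hp.trans (List.prefix_append _ _)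
      have h2 : y ++ q2 <+: q2 ++ Z := (List.prefix_append_right_inj _).1 h1
      have h3 : q2 ++ y <+: q2 ++ Z := (List.prefix_append_right_inj _).2 hyZ
      have h4 : y ++ q2 <+: q2 ++ y :=
        List.prefix_of_prefix_length_le h2 h3 (by simp; omega)
      have h5 : y ++ q2 = q2 ++ y := h4.eq_of_length (by simp; omega)
      exact (CommW.append (show CommW y y from rfl) (CommW.symm h5)).symm
    · obtain ⟨y', rfl⟩ := List.prefix_of_prefix_length_le hqZ hyZ hl
      have h1 : q ++ (y' ++ q) <+: q ++ Z := by
        have : q ++ Z = Z ++ q := hZ.symm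
        rw [this, ← List.append_assoc]
        exact hp.trans (List.prefix_append _ _)
      have h2 : y' ++ q <+: Z := (List.prefix_append_right_inj _).1 h1
      rcases ih y' (by simp at hy; omega) h2 with h | h
      · left
        exact CommW.append rfl h
      · exact Or.inr h

theorem strip_common {A B : Type*} (g : A → List B) (hg : ∀ a, g a ≠ []) (p : List A) :
    ∀ q : List A, p ≠ q → p.flatMap g = q.flatMap g →
      ∃ a b p' q', a ≠ b ∧ (a :: p').flatMap g = (b :: q').flatMap g ∧ g a <+: g b := by
  induction p with
  | nil =>
    intro q hpq h
    cases q with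
    | nil => exact absurd rfl hpq
    | cons b q => simp at h; exact absurd h.1 (hg b)
  | cons a p ih =>
    intro q hpq h
    cases q with
    | nil => simp at h; exact absurd h.1 (hg a)
    | cons b q =>
      by_cases hab : a = b
      · subst hab
        refine ih q (fun h' => hpq (by rw [h'])) ?_
        simpa using h
      · have h1 : g a <+: (a :: p).flatMap g := by simp
        have h2 : g b <+: (a :: p).flatMap g := by rw [h]; simp
        rcases le_total (g a).length (g b).length with hl | hl
        · exact ⟨a, b, p, q, hab, h, List.prefix_of_prefix_length_le h1 h2 hl⟩
        · exact ⟨b, a, q, p, Ne.symm hab, h.symm, List.prefix_of_prefix_length_le h2 h1 hl⟩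

theorem defect {A : Type u} {B : Type*} [Fintype A] (N : ℕ) : ∀ g : A → List B,
    (∀ a, g a ≠ []) → (∑ a, (g a).length) ≤ N → ∀ p q : List A, p ≠ q →
    p.flatMap g = q.flatMap g →
    ∃ (Y : Type u) (_ : Fintype Y) (α : A → List Y) (β : Y → List B),
      Fintype.card Y < Fintype.card A ∧ (∀ a, α a ≠ []) ∧ (∀ y, β y ≠ []) ∧
      ∀ a, g a = (α a).flatMap β := by
  classical
  induction N with
  | zero =>
    intro g hg hs p q hpq h
    obtain ⟨a, -⟩ := strip_common g hg p q hpq h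
    have h1 : (g a).length ≤ ∑ a, (g a).length :=
      Finset.single_le_sum (f := fun a => (g a).length) (fun _ _ => Nat.zero_le _)
        (Finset.mem_univ a)
    have := List.length_pos_iff.2 (hg a)
    omega
  | succ N ih =>
    intro g hg hs p q hpq h
    obtain ⟨a, b, p', q', hab, he, t, ht⟩ := strip_common g hg p q hpq h
    by_cases htn : t = []
    · subst htn
      simp at ht
      refine ⟨{c : A // c ≠ b}, inferInstance,
        fun c => if hc : c = b then [⟨a, hab⟩] else [⟨c, hc⟩], fun y => g y.1, ?_, ?_, ?_, ?_⟩
      · exact Fintype.card_subtype_lt (x := b) (by simp)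
      · intro c; dsimp; split <;> simp
      · intro y; exact hg _
      · intro c
        by_cases hc : c = b
        · subst hc; simp [ht]
        · simp [hc]
    · let φ : A → List A := fun c => if c = b then [a, b] else [c]
      let g1 : A → List B := fun c => if c = b then t else g c
      have hfac : ∀ c, g c = (φ c).flatMap g1 := by
        intro c
        by_cases hc : c = b
        · subst hc; simp [φ, g1, hab, ht]
        · simp [φ, g1, hc]
      have hg1 : ∀ c, g1 c ≠ [] := by
        intro c
        by_cases hc : c = b
        · simp [g1, hc, htn]
        · simp [g1, hc, hg]
      have hsum : ∑ c, (g1 c).length < ∑ c, (g c).length := by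
        apply Finset.sum_lt_sum
        · intro c _
          by_cases hc : c = b
          · subst hc; simp [g1, ← ht]
          · simp [g1, hc]
        · refine ⟨b, Finset.mem_univ _, ?_⟩
          have := List.length_pos_iff.2 (hg a)
          rw [← ht]; simp [g1]; exact this
      have hass : ∀ w : List A, w.flatMap g = (w.flatMap φ).flatMap g1 := by
        intro w
        rw [List.flatMap_assoc]
        congr 1
        funext c; exact hfac c
      have hne : (a :: p').flatMap φ ≠ (b :: q').flatMap φ := by
        intro hh
        simp [φ, hab] at hh
        cases p' with
        | nil => simp at hh
        | cons c p' =>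
          by_cases hc : c = b
          · simp [hc, hab] at hh
          · simp [hc] at hh
      obtain ⟨Y, hY, α, β, hc, hα, hβ, hαβ⟩ := ih g1 hg1 (by omega) _ _ hne
        (by rw [← hass, ← hass]; exact he)
      refine ⟨Y, hY, fun c => (φ c).flatMap α, β, hc, ?_, hβ, ?_⟩
      · intro c
        by_cases hc : c = b
        · simp [φ, hc, hα]
        · simp [φ, hc, hα]
      · intro c
        rw [hfac, List.flatMap_assoc]
        congr 1
        funext d; exact hαβ d

theorem length_le_flatMap {A B : Type*} (g : A → List B) (hg : ∀ a, g a ≠ []) (w : List A) :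
    w.length ≤ (w.flatMap g).length := by
  induction w with
  | nil => simp
  | cons a w ih =>
    have := List.length_pos_iff.2 (hg a)
    rw [List.flatMap_cons, List.length_append, List.length_cons]; omega

theorem length_le_iter {A : Type*} (g : A → List A) (hg : ∀ a, g a ≠ []) (k : ℕ) (w : List A) :
    w.length ≤ (iterM g k w).length := by
  induction k with
  | zero => exact le_rfl
  | succ k ih => rw [iter_succ]; exact ih.trans (length_le_flatMap g hg _)

theorem iter_letter_le {A : Type*} (g : A → List A) (k : ℕ) {a : A} {w : List A} (h : a ∈ w) :
    (iterM g k [a]).length ≤ (iterM g k w).length := by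
  obtain ⟨s, t, rfl⟩ := List.append_of_mem h
  have : s ++ a :: t = s ++ ([a] ++ t) := rfl
  rw [this, homW_iter, homW_iter]
  simp; omega

theorem iter_comm_self {A : Type*} (g : A → List A) (hg : ∀ a, g a ≠ []) {v : List A}
    (hv : v ≠ []) (h : CommW (applyM g v) v) (k : ℕ) : CommW (iterM g k v) v := by
  induction k with
  | zero => rfl
  | succ k ih =>
    rw [iter_succ]
    refine comm_trans ?_ (HomW.comm (homW_apply g) ih) h
    have h1 := length_le_flatMap g hg v
    have := List.length_pos_iff.2 hv
    exact List.length_pos_iff.1 (lt_of_lt_of_le this h1)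

theorem inj_case {A : Type u} [Fintype A] (g : A → List A) (hg : ∀ a, g a ≠ [])
    (hgr : ∀ a N, ∃ m, N ≤ (iterM g m [a]).length) (hinj : Function.Injective (applyM g))
    (x : A) (v' : List A) (hc : CommW (applyM g (x :: v')) (x :: v'))
    (n : ℕ) (hn : Fintype.card A ≤ n) :
    ∃ w, w ≠ [] ∧ CommW w (x :: v') ∧ w <+: iterM g n [x] := by
  classical
  set v := x :: v' with hv
  have hvne : v ≠ [] := by simp [hv]
  -- a shortest word commuting with v
  have hex : ∃ l, ∃ w : List A, w.length = l ∧ w ≠ [] ∧ CommW w v := ⟨_, v, rfl, hvne, rfl⟩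
  obtain ⟨w, hwl, hwne, hwv⟩ := Nat.find_spec hex
  have hmin : ∀ c : List A, c ≠ [] → CommW c w → w.length ≤ c.length := by
    intro c hcne hcw
    rw [hwl]
    exact Nat.find_min' hex ⟨c, rfl, hcne, comm_trans hwne hcw hwv⟩
  have hgw : ∀ m, CommW (iterM g m w) w := by
    intro m
    apply iter_comm_self g hg hwne
    have h1 : CommW (applyM g w) (applyM g v) := HomW.comm (homW_apply g) hwv
    have h2 : applyM g v ≠ [] := by
      have h1 := length_le_flatMap g hg v
      have := List.length_pos_iff.2 hvne
      exact List.length_pos_iff.1 (lt_of_lt_of_le this h1)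
    exact comm_trans hvne (comm_trans h2 h1 hc) hwv.symm
  have hnd : w.Nodup := by
    by_contra hnd
    obtain ⟨a, ha⟩ : ∃ a, List.Duplicate a w := by
      by_contra hno
      exact hnd (List.nodup_iff_forall_not_duplicate.2 (fun a h => hno ⟨a, h⟩))
    obtain ⟨r, z, t, hw⟩ : ∃ r z t, w = r ++ ([a] ++ z ++ [a] ++ t) := by
      have h2 := List.duplicate_iff_sublist.1 ha
      obtain ⟨r, s, h3, h4, h5⟩ := List.cons_sublist_iff.1 h2
      obtain ⟨r1, r2, rfl⟩ := List.append_of_mem h4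
      obtain ⟨s1, s2, rfl⟩ := List.append_of_mem (List.singleton_sublist.1 h5)
      exact ⟨r1, r2 ++ s1, s2, by simp [h3]⟩
    obtain ⟨m, hm⟩ := hgr a w.length
    set F := iterM g m with hF
    have hFh : HomW F := homW_iter g m
    have hFle : ∀ z, z.length ≤ (F z).length := length_le_iter g hg m
    have hFinj : Function.Injective F := hinj.iterate m
    have hFw : F w ≠ [] := by
      have := hFle w
      have := List.length_pos_iff.2 hwne
      exact List.length_pos_iff.1 (by omega)
    have e1 : F w = F r ++ F ([a] ++ z ++ [a] ++ t) := by rw [hw, hFh]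
    obtain ⟨q, hql, hq⟩ : ∃ q, q.length = w.length ∧ CommW q (F ([a] ++ z ++ [a] ++ t) ++ F r) := by
      apply comm_rotate
      rw [← e1]; exact (hgw m).symm
    have hqne : q ≠ [] := by
      have := List.length_pos_iff.2 hwne
      exact List.length_pos_iff.1 (by omega)
    set Z := F ([a] ++ z ++ [a] ++ t) ++ F r with hZ
    have eZ : Z = F ([a] ++ z) ++ (F [a] ++ (F t ++ F r)) := by
      rw [hZ, hFh ([a] ++ z ++ [a]), hFh ([a] ++ z)]; simp
    have hqA : q <+: F [a] := by
      have hAZ : F [a] <+: Z := by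
        rw [eZ, hFh [a] z, List.append_assoc]; exact List.prefix_append _ _
      have hqZ : q <+: Z := prefix_of_comm hq (by have := hAZ.length_le; omega)
      exact List.prefix_of_prefix_length_le hqZ hAZ (by omega)
    have hyq : F ([a] ++ z) ++ q <+: Z := by
      rw [eZ]
      exact (List.prefix_append_right_inj _).2 (hqA.trans (List.prefix_append _ _))
    -- transfer of a short commuting word back to w
    have back : ∀ c, c ≠ [] → CommW c Z → w.length ≤ c.length := by
      intro c hcne hcZ
      obtain ⟨c', hl, hc'⟩ := comm_rotate _ _ _ hcZ
      rw [← e1] at hc'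
      have hcp := List.length_pos_iff.2 hcne
      rw [← hl]
      exact hmin c' (List.length_pos_iff.1 (by omega)) (comm_trans hFw hc' (hgw m))
    rcases occ_lemma hqne hq.symm _ _ le_rfl hyq with h | ⟨c, h1, h2, h3⟩
    · have h1 : CommW (F ([a] ++ z)) Z := comm_trans hqne h hq
      have h2 : CommW ([a] ++ z) (([a] ++ z ++ [a] ++ t) ++ r) := by
        apply hFinj
        have e2 := hFh ([a] ++ z ++ [a] ++ t) r
        rw [hFh ([a] ++ z), hFh _ ([a] ++ z), e2]
        exact h1
      obtain ⟨c', hl, hc'⟩ := comm_rotate _ _ _ h2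
      rw [← hw] at hc'
      have := hmin c' (List.length_pos_iff.1 (by rw [hl]; simp)) hc'
      rw [hl, hw] at this
      simp at this
      omega
    · have := back c h1 (comm_trans hqne h3 hq)
      omega
  have hwn : w.length ≤ n := hnd.length_le_card.trans hn
  -- growth of x
  have hgx : ∃ t, g x = x :: t := by
    unfold CommW at hc
    rw [hv] at hc
    obtain ⟨b, l, hbl⟩ := List.exists_cons_of_ne_nil (hg x)
    simp [applyM, hbl] at hc
    exact ⟨l, by rw [hbl, hc.1]⟩
  obtain ⟨t, ht⟩ := hgx
  have htne : t ≠ [] := by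
    rintro rfl
    obtain ⟨m, hm⟩ := hgr x 2
    have : ∀ m, iterM g m [x] = [x] := by
      intro m
      induction m with
      | zero => rfl
      | succ m ih => rw [iter_succ, ih, apply_singleton, ht]
    rw [this] at hm
    simp at hm
  have hlen : ∀ m, m ≤ (iterM g m [x]).length := by
    intro m
    induction m with
    | zero => exact Nat.zero_le _
    | succ m ih =>
      have e : g x = [x] ++ t := ht
      rw [iter_succ', apply_singleton, e, homW_iter, List.length_append]
      have := length_le_iter g hg m t
      have := List.length_pos_iff.2 htne
      omega
  refine ⟨w, hwne, hwv, ?_⟩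
  have h1 : CommW (iterM g n v) w :=
    comm_trans hvne (iter_comm_self g hg hvne hc n) hwv.symm
  have h2 : iterM g n [x] <+: iterM g n v := HomW.mono (homW_iter g n) ⟨v', rfl⟩
  have h3 := hlen n
  have h4 : w <+: iterM g n v := prefix_of_comm h1.symm (by have := h2.length_le; omega)
  exact List.prefix_of_prefix_length_le h4 h2 (by omega)

theorem main_root (n : ℕ) : ∀ (A : Type u) [Fintype A] (g : A → List A), (∀ a, g a ≠ []) →
    (∀ a N, ∃ m, N ≤ (iterM g m [a]).length) → ∀ (x : A) (v' : List A),
    CommW (applyM g (x :: v')) (x :: v') → Fintype.card A ≤ n →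
    ∃ w, w ≠ [] ∧ CommW w (x :: v') ∧ w <+: iterM g n [x] := by
  induction n with
  | zero =>
    intro A _ g hg hgr x v' hc hn
    exact inj_case g hg hgr (fun a b _ => by
      have : IsEmpty A := Fintype.card_eq_zero_iff.1 (by omega)
      exact this.elim x) x v' hc _ hn
  | succ n ih =>
    intro A _ g hg hgr x v' hc hn
    by_cases hinj : Function.Injective (applyM g)
    · exact inj_case g hg hgr hinj x v' hc _ hn
    obtain ⟨p, q, hpq, hne⟩ : ∃ p q, applyM g p = applyM g q ∧ p ≠ q := by
      simpa [Function.Injective] using hinj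
    obtain ⟨Y, _, α, β, hcard, hα, hβ, hfac⟩ := defect _ g hg le_rfl p q hne hpq
    let g' : Y → List Y := fun y => (β y).flatMap α
    have hgF : ∀ w, applyM g w = (w.flatMap α).flatMap β := by
      intro w
      rw [List.flatMap_assoc]
      unfold applyM
      congr 1; funext a; exact hfac a
    have hgF' : ∀ w, applyM g' w = (w.flatMap β).flatMap α := by
      intro w
      rw [List.flatMap_assoc]
      rfl
    have hg' : ∀ y, g' y ≠ [] := by
      intro y
      have h1 := length_le_flatMap α hα (β y)
      have := List.length_pos_iff.2 (hβ y)
      exact List.length_pos_iff.1 (by show 0 < ((β y).flatMap α).length; omega)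
    have hsemi : ∀ k w, (iterM g' k w).flatMap β = iterM g k (w.flatMap β) := by
      intro k w
      induction k with
      | zero => rfl
      | succ k ih2 => rw [iter_succ, iter_succ, hgF', hgF, ih2]
    have hgr' : ∀ y N, ∃ m, N ≤ (iterM g' m [y]).length := by
      intro y N
      obtain ⟨b, l, hbl⟩ := List.exists_cons_of_ne_nil (hβ y)
      obtain ⟨m, hm⟩ := hgr b N
      refine ⟨m+1, hm.trans ?_⟩
      rw [iter_succ, hgF', hsemi]
      refine le_trans ?_ (length_le_flatMap α hα _)
      apply iter_letter_le
      simp [hbl]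
    obtain ⟨y, l, hyl⟩ := List.exists_cons_of_ne_nil (hα x)
    have hαv : (x :: v').flatMap α = y :: (l ++ v'.flatMap α) := by simp [hyl]
    have hc' : CommW (applyM g' (y :: (l ++ v'.flatMap α))) (y :: (l ++ v'.flatMap α)) := by
      rw [← hαv, hgF', ← hgF]
      exact HomW.comm (homW_flatMap α) hc
    obtain ⟨w', hw'ne, hw'c, hw'p⟩ := ih Y g' hg' hgr' y _ hc' (by omega)
    refine ⟨w'.flatMap β, ?_, ?_, ?_⟩
    · have h1 := length_le_flatMap β hβ w'
      have := List.length_pos_iff.2 hw'ne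
      exact List.length_pos_iff.1 (by omega)
    · rw [← hαv] at hw'c
      have h1 : CommW (w'.flatMap β) (((x :: v').flatMap α).flatMap β) :=
        HomW.comm (homW_flatMap β) hw'c
      rw [← hgF] at h1
      refine comm_trans ?_ h1 hc
      have h1 := length_le_flatMap g hg (x :: v')
      exact List.length_pos_iff.1 (lt_of_lt_of_le (by simp) h1)
    · have h1 : w'.flatMap β <+: (iterM g' n [y]).flatMap β :=
        HomW.mono (homW_flatMap β) hw'p
      have h2 : iterM g' n [y] <+: iterM g' n ([x].flatMap α) :=
        HomW.mono (homW_iter g' n) (by simp [hyl])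
      have h3 : (iterM g' n ([x].flatMap α)).flatMap β = iterM g (n+1) [x] := by
        rw [hsemi, ← hgF, iter_succ']
      rw [← h3]
      exact h1.trans (HomW.mono (homW_flatMap β) h2)

/-! Infinite words. -/

theorem isPrefI_of_prefix {A : Type*} {w z : List A} {s : ℕ → A} (h : w <+: z)
    (hz : IsPrefI z s) : IsPrefI w s := by
  intro i hi
  rw [← hz i (lt_of_lt_of_le hi h.length_le)]
  exact h.getElem hi

theorem prefix_of_isPrefI {A : Type*} {w z : List A} {s : ℕ → A} (hw : IsPrefI w s)
    (hz : IsPrefI z s) (h : w.length ≤ z.length) : w <+: z := by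
  rw [List.prefix_iff_eq_take]
  apply List.ext_getElem
  · simp [h]
  · intro i h1 h2
    rw [hw i h1, List.getElem_take, hz i]

theorem isPrefI_apply {A : Type*} {g : A → List A} {x : A} {s : ℕ → A} (hs : IsOmega g x s)
    {w : List A} (hw : IsPrefI w s) : IsPrefI (applyM g w) s := by
  obtain ⟨i, hi⟩ := (hs.1.2.eventually (eventually_ge_atTop w.length)).exists
  have h1 := prefix_of_isPrefI hw (hs.2 i) hi
  have h2 := HomW.mono (homW_apply g) h1
  rw [← iter_succ] at h2
  exact isPrefI_of_prefix h2 (hs.2 _)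

theorem prim_mul {A : Type*} {g : A → List A} {K : ℕ} (h : ∀ a b : A, a ∈ iterM g K [b]) (j : ℕ) :
    ∀ a b : A, a ∈ iterM g (K * (j+1)) [b] := by
  induction j with
  | zero => simpa using h
  | succ j ih =>
    intro a b
    have e : K * (j + 1 + 1) = K + K * (j+1) := by ring
    rw [e, iter_add]
    obtain ⟨s, t, hst⟩ := List.append_of_mem (ih b b)
    rw [hst]
    have : s ++ b :: t = s ++ ([b] ++ t) := rfl
    rw [this, homW_iter, homW_iter]
    simp [h a b]

theorem prim_nonerasing {A : Type*} {g : A → List A} (hg : Primitive g) (a : A) : g a ≠ [] := by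
  obtain ⟨K, hK, h⟩ := hg
  intro h0
  obtain ⟨K, rfl⟩ : ∃ k, K = k + 1 := ⟨K - 1, by omega⟩
  have := h a a
  rw [iter_succ', apply_singleton, h0, HomW.nil (homW_iter g K)] at this
  simp at this

theorem iter_powM {A : Type*} (g : A → List A) (k j : ℕ) (w : List A) :
    iterM (powM g k) j w = iterM g (k * j) w := by
  have h1 : ∀ w, applyM (powM g k) w = iterM g k w := by
    intro w
    induction w with
    | nil => rw [HomW.nil (homW_iter g k)]; rfl
    | cons a w ih =>
      have : a :: w = [a] ++ w := rfl
      rw [this, homW_apply, homW_iter, ih, apply_singleton]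
      rfl
  induction j with
  | zero => rfl
  | succ j ih => rw [iter_succ, ih, h1, ← iter_add]; congr 1; ring

theorem periodic_of_looping {A : Type*} {g : A → List A} (hg : Primitive g) {x : A} {s : ℕ → A}
    (hs : IsOmega g x s) (hl : Looping g) : ∃ p, 0 < p ∧ ∀ i, s (i + p) = s i := by
  obtain ⟨k, hk, y, u, t, ht, hu, hper⟩ := hl
  obtain ⟨K, hK, hprim⟩ := hg
  have hup := List.length_pos_iff.2 hu
  refine ⟨u.length, hup, fun i => ?_⟩
  have htp : ∀ i, t (i + u.length) = t i := by
    intro i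
    rw [hper _ (Nat.mod_lt _ hup), hper i (Nat.mod_lt _ hup)]
    simp
  obtain ⟨J, hJ⟩ := eventually_atTop.1 (hs.1.2.eventually (eventually_ge_atTop (i + u.length + 1)))
  have hlen := hJ (k * J) (Nat.le_mul_of_pos_left _ hk)
  obtain ⟨k, rfl⟩ : ∃ k', k = k' + 1 := ⟨k - 1, by omega⟩
  have hx := prim_mul hprim k x y
  obtain ⟨a, b, hab⟩ := List.append_of_mem hx
  have h1 := ht.2 (J + K)
  have e : iterM (powM g (k+1)) (J + K) [y] =
      iterM g ((k+1) * J) a ++ (iterM g ((k+1) * J) [x] ++ iterM g ((k+1) * J) b) := by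
    rw [iter_powM, mul_add, iter_add, mul_comm (k+1) K, hab]
    have : a ++ x :: b = a ++ ([x] ++ b) := rfl
    rw [this, homW_iter, homW_iter]
  rw [e] at h1
  have hs' := hs.2 ((k+1) * J)
  set W := iterM g ((k+1) * J) [x]
  set P := iterM g ((k+1) * J) a
  have key : ∀ j (hj : j < W.length), s j = t (P.length + j) := by
    intro j hj
    rw [← hs' j hj, ← h1 (P.length + j) (by simp; omega)]
    rw [List.getElem_append_right (by omega)]
    simp [List.getElem_append_left, hj]
  rw [key _ (by omega), key i (by omega), ← htp (P.length + i)]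
  congr 1
  omega

theorem exists_comm_word {A : Type*} {g : A → List A} (hne : ∀ a, g a ≠ []) {x : A} {s : ℕ → A}
    (hs : IsOmega g x s) {p : ℕ} (hp : 0 < p) (hper : ∀ i, s (i + p) = s i) :
    ∃ v', CommW (applyM g (x :: v')) (x :: v') := by
  let v : List A := List.ofFn (fun i : Fin p => s i)
  have hvl : v.length = p := by simp [v]
  have hv : IsPrefI v s := by
    intro i hi
    simp [v]
  have hcat : ∀ w, IsPrefI w s → IsPrefI (v ++ w) s := by
    intro w hw i hi
    rw [List.getElem_append]
    split
    · exact hv i _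
    · rw [hw]
      rw [hvl, ← hper]
      congr 1
      omega
  have hx0 : s 0 = x := by
    have := hs.2 0 0 (by simp [iter_zero])
    simpa [iter_zero] using this.symm
  obtain ⟨b, v', hbv⟩ := List.exists_cons_of_ne_nil (List.length_pos_iff.1 (by omega) : v ≠ [])
  have hb : b = x := by
    have := hv 0 (by omega)
    simp [hbv] at this
    rw [this, hx0]
  subst hb
  refine ⟨v', ?_⟩
  rw [← hbv]
  have h1 : IsPrefI (applyM g v) s := isPrefI_apply hs hv
  have h2 : IsPrefI (applyM g v ++ applyM g v) s := by
    rw [← homW_apply]; exact isPrefI_apply hs (hcat v hv)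
  have h3 : v <+: applyM g v := prefix_of_isPrefI hv h1 (length_le_flatMap g hne v)
  have h4 : IsPrefI (applyM g v ++ v) s :=
    isPrefI_of_prefix ((List.prefix_append_right_inj _).2 h3) h2
  have hle : (applyM g v ++ v).length = (v ++ applyM g v).length := by simp; omega
  exact (prefix_of_isPrefI h4 (hcat _ h1) hle.le).eq_of_length hle

/-! Balance. -/

/-- The `n`-fold power of a word. -/
def npw {A : Type*} (n : ℕ) (w : List A) : List A := (List.replicate n w).flatten

theorem npw_succ {A : Type*} (n : ℕ) (w : List A) : npw (n+1) w = w ++ npw n w := by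
  simp [npw, List.replicate_succ]

theorem npw_comm {A : Type*} (n : ℕ) {a b : List A} (h : CommW a b) : CommW (npw n a) b := by
  induction n with
  | zero => simp [npw, CommW]
  | succ n ih => rw [npw_succ]; exact CommW.append h ih

theorem npw_hom {A B : Type*} {F : List A → List B} (hF : HomW F) (n : ℕ) (w : List A) :
    (F (npw n w)).length = n * (F w).length := by
  induction n with
  | zero => simp [npw, HomW.nil hF]
  | succ n ih => rw [npw_succ, hF, List.length_append, ih]; ring

theorem comm_length {A B : Type*} {F : List A → List B} (hF : HomW F) {a b : List A}
    (h : CommW a b) : b.length * (F a).length = a.length * (F b).length := by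
  rw [← npw_hom hF, ← npw_hom hF]
  have h1 : CommW (npw b.length a) (npw a.length b) := (npw_comm _ (npw_comm _ h).symm).symm
  have h2 : (npw b.length a).length = (npw a.length b).length := by
    have e1 := npw_hom (F := fun w : List A => w) (fun _ _ => rfl) b.length a
    have e2 := npw_hom (F := fun w : List A => w) (fun _ _ => rfl) a.length b
    rw [e1, e2, mul_comm]
  rw [(prefix_of_comm h1 h2.le).eq_of_length h2]

theorem bal_bound {A : Type*} {g h : A → List A} (hbal : BAL g h < ⊤) :
    ∃ B : ℕ, ∀ x k, (((applyM g (iterM g k [x])).length : ℤ) -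
      ((applyM h (iterM g k [x])).length : ℤ)).natAbs ≤ B := by
  obtain ⟨B, hB⟩ := ENat.ne_top_iff_exists.1 hbal.ne
  refine ⟨B, fun x k => ?_⟩
  have h1 : ((((applyM g (iterM g k [x])).length : ℤ) -
      ((applyM h (iterM g k [x])).length : ℤ)).natAbs : ℕ∞) ≤ BAL g h :=
    le_iSup₂ (f := fun (x : A) (k : ℕ) => ((((applyM g (iterM g k [x])).length : ℤ) -
      ((applyM h (iterM g k [x])).length : ℤ)).natAbs : ℕ∞)) x k
  rw [← hB] at h1
  exact_mod_cast h1

theorem bal_zero {A : Type*} {g h : A → List A} (hg : ∀ a, g a ≠ [])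
    (hgr : ∀ a N, ∃ m, N ≤ (iterM g m [a]).length) (hbal : BAL g h < ⊤) {w : List A}
    (hw : w ≠ []) (hc : CommW (applyM g w) w) : (applyM g w).length = (applyM h w).length := by
  obtain ⟨B, hB⟩ := bal_bound hbal
  have hsum : ∀ k (z : List A), (((applyM g (iterM g k z)).length : ℤ) -
      ((applyM h (iterM g k z)).length : ℤ)).natAbs ≤ z.length * B := by
    intro k z
    induction z with
    | nil => simp [HomW.nil (homW_iter g k), HomW.nil (homW_apply _)]
    | cons a z ih =>
      have e : a :: z = [a] ++ z := rfl
      rw [e, homW_iter, homW_apply, homW_apply]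
      have := hB a k
      simp only [List.length_append, List.length_singleton, add_mul, one_mul]
      push_cast
      omega
  by_contra hne
  obtain ⟨a, ha⟩ := List.exists_mem_of_ne_nil w hw
  obtain ⟨m, hm⟩ := hgr a (w.length * (w.length * B) + 1)
  have hm' := hm.trans (iter_letter_le g m ha)
  have hcm := iter_comm_self g hg hw hc m
  have e1 := comm_length (homW_apply g) hcm
  have e2 := comm_length (homW_apply h) hcm
  have hs := hsum m w
  set G := (applyM g (iterM g m w)).length
  set H := (applyM h (iterM g m w)).length
  set L := (iterM g m w).length
  have e3 : (w.length : ℤ) * ((G : ℤ) - H) =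
      L * (((applyM g w).length : ℤ) - (applyM h w).length) := by
    rw [mul_sub, mul_sub]
    exact_mod_cast congrArg₂ (fun a b : ℤ => a - b) (congrArg Nat.cast e1) (congrArg Nat.cast e2)
  have e4 := congrArg Int.natAbs e3
  rw [Int.natAbs_mul, Int.natAbs_mul] at e4
  simp only [Int.natAbs_natCast] at e4
  have h5 : 1 ≤ (((applyM g w).length : ℤ) - (applyM h w).length).natAbs := by omega
  have h6 : L ≤ w.length * (w.length * B) := by
    calc L = L * 1 := by ring
      _ ≤ L * (((applyM g w).length : ℤ) - (applyM h w).length).natAbs := Nat.mul_le_mul_left _ h5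
      _ = w.length * ((G : ℤ) - H).natAbs := e4.symm
      _ ≤ _ := Nat.mul_le_mul_left _ hs
  omega

theorem eq_of_prefixes {A : Type*} {g h : A → List A} {x : A} {s t : ℕ → A}
    (hs : IsOmega g x s) (ht : IsOmega h x t)
    (hp : ∀ j, ∃ Z, iterM g j [x] <+: Z ∧ iterM h j [x] <+: Z) : s = t := by
  funext i
  obtain ⟨j, h1, h2⟩ := ((hs.1.2.eventually (eventually_ge_atTop (i+1))).and
    (ht.1.2.eventually (eventually_ge_atTop (i+1)))).exists
  obtain ⟨Z, h3, h4⟩ := hp j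
  rw [← hs.2 j i h1, ← ht.2 j i h2, h3.getElem, h4.getElem]

end LoopAux

open LoopAux
/-- (Lemma 14 of the paper.) Let `g, h` be primitive, `g`
looping and `BAL(g,h) < ∞`.  Then `g^ω(x) = h^ω(x)` iff `g^{2n}(x) ∈ COMP(g,h)`. -/
theorem looping_equality_criterion {X : Type*} [Fintype X]
    (n : ℕ) (hn : n = Fintype.card X) (hn2 : 2 ≤ n)
    (g h : X → List X) (hg : Primitive g) (hh : Primitive h)
    (x : X) (sg sh : ℕ → X) (hsg : IsOmega g x sg) (hsh : IsOmega h x sh)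
    (hloop : Looping g) (hbal : BAL g h < ⊤) :
    sg = sh ↔ iterM g (2 * n) [x] ∈ COMP g h := by
  constructor
  · rintro rfl
    have h1 := isPrefI_apply hsg (hsg.2 (2 * n))
    have h2 := isPrefI_apply hsh (hsg.2 (2 * n))
    rcases le_total (applyM g (iterM g (2*n) [x])).length (applyM h (iterM g (2*n) [x])).length
      with hl | hl
    · obtain ⟨u, hu⟩ := prefix_of_isPrefI h1 h2 hl
      exact ⟨u, [], by simpa using hu⟩
    · obtain ⟨u, hu⟩ := prefix_of_isPrefI h2 h1 hl
      exact ⟨[], u, by simpa using hu.symm⟩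
  · intro hcomp
    have hge := prim_nonerasing hg
    have hhe := prim_nonerasing hh
    have hgr : ∀ a N, ∃ m, N ≤ (iterM g m [a]).length := by
      intro a N
      obtain ⟨K, hK, hprim⟩ := hg
      obtain ⟨i, hi⟩ := (hsg.1.2.eventually (eventually_ge_atTop N)).exists
      refine ⟨i + K, hi.trans ?_⟩
      rw [iter_add]
      exact iter_letter_le g i (hprim x a)
    obtain ⟨p, hp, hper⟩ := periodic_of_looping hg hsg hloop
    obtain ⟨v', hv'⟩ := exists_comm_word hge hsg hp hper
    obtain ⟨w, hwne, hwv, hwp⟩ := main_root n X g hge hgr x v' hv' (by omega)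
    have hgvne : applyM g (x :: v') ≠ [] := by
      have h1 := length_le_flatMap g hge (x :: v')
      exact List.length_pos_iff.1 (lt_of_lt_of_le (by simp) h1)
    have hgw : CommW (applyM g w) w :=
      comm_trans (by simp) (comm_trans hgvne (HomW.comm (homW_apply g) hwv) hv') hwv.symm
    have hxw : [x] <+: w := by
      have h1 : [x] <+: x :: v' := by simp
      have hl : 1 ≤ w.length := List.length_pos_iff.2 hwne
      have h2 : x :: v' <+: w ++ (x :: v') := ⟨w, hwv.symm⟩
      exact List.prefix_of_prefix_length_le (h1.trans h2) (List.prefix_append _ _) (by simpa using hl)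
    have hw2 : w <+: iterM g (2 * n) [x] := by
      have h1 := hsg.2 n
      have h2 := hsg.2 (2*n)
      have e : 2 * n = n + n := by ring
      refine hwp.trans (prefix_of_isPrefI h1 h2 ?_)
      rw [e, iter_add]
      exact length_le_iter g hge _ _
    have hbz := bal_zero hge hgr hbal hwne hgw
    have hEq : applyM g w = applyM h w := by
      obtain ⟨u₁, u₂, hu⟩ := hcomp
      have h1 := (HomW.mono (homW_apply g) hw2).trans (List.prefix_append _ u₁)
      have h2 := (HomW.mono (homW_apply h) hw2).trans (List.prefix_append _ u₂)
      rw [hu] at h1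
      exact (List.prefix_of_prefix_length_le h1 h2 hbz.le).eq_of_length hbz
    have hhw : CommW (applyM h w) w := hEq ▸ hgw
    apply eq_of_prefixes hsg hsh
    intro j
    have c1 := iter_comm_self g hge hwne hgw j
    have c2 := iter_comm_self h hhe hwne hhw j
    have c3 : CommW (iterM g j w) (iterM h j w) := comm_trans hwne c1 c2.symm
    refine ⟨iterM g j w ++ iterM h j w, ?_, ?_⟩
    · exact (HomW.mono (homW_iter g j) hxw).trans (List.prefix_append _ _)
    · rw [show iterM g j w ++ iterM h j w = iterM h j w ++ iterM g j w from c3]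
      exact (HomW.mono (homW_iter h j) hxw).trans (List.prefix_append _ _)
end
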